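/- arXiv:1511.05624 — 2 statements merged into one kernel-verified Lean document; each statement's English description precedes it below -/
import Mathlib

section
/- For every a ∈ S and every x ∈ FL(S), one has ⁅of a, x⁆ = 0 if and only if x is a ℚ-scalar multiple of of a. (The centralizer of a generator of the free Lie algebra over ℚ is its one-dimensional span.) -/
namespace FreeLieAlgebra

attribute [local instance] LieRing.ofAssociativeRing

section CommRing

variable {R : Type*} [CommRing R] {X : Type*}

theorem lieSubalgebra_eq_top_of_forall_of_mem (K : LieSubalgebra R (FreeLieAlgebra R X))
    (h : ∀ s, of R s ∈ K) : K = ⊤ := by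
  have key : K.incl.comp (lift R fun s => (⟨of R s, h s⟩ : K)) = LieHom.id :=
    hom_ext fun s => by simp
  refine eq_top_iff.2 fun u _ => ?_
  have hu := congr($key u)
  simp only [LieHom.comp_apply, LieHom.id_apply] at hu
  rw [← hu]
  exact SetLike.coe_mem _

variable (R) in
/-- The operator `(v, c) ↦ (⁅of s, v⁆ + c • of s, 0)` attached to a generator `s`. -/
noncomputable def affineAdOf (s : X) : Module.End R (FreeLieAlgebra R X × R) :=
  LinearMap.inl R _ _ ∘ₗ
    (LieAlgebra.ad R _ (of R s) : FreeLieAlgebra R X →ₗ[R] FreeLieAlgebra R X).coprod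
      (LinearMap.toSpanSingleton R _ (of R s))

@[simp]
theorem affineAdOf_apply (s : X) (p : FreeLieAlgebra R X × R) :
    affineAdOf R s p = (⁅of R s, p.1⁆ + p.2 • of R s, 0) := by
  simp [affineAdOf]

variable (R X) in
/-- The representation of the free Lie algebra on `FreeLieAlgebra R X × R` extending
`affineAdOf`. -/
noncomputable def affineAd :
    FreeLieAlgebra R X →ₗ⁅R⁆ Module.End R (FreeLieAlgebra R X × R) :=
  lift R (affineAdOf R)

theorem affineAd_of (s : X) : affineAd R X (of R s) = affineAdOf R s :=
  lift_of_apply _ _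

variable (R X) in
/-- The derivation of the free Lie algebra that is the identity on generators, read off from
`affineAd`. -/
noncomputable def euler : Module.End R (FreeLieAlgebra R X) :=
  LinearMap.fst R _ _ ∘ₗ LinearMap.applyₗ (0, (1 : R)) ∘ₗ
    (affineAd R X : _ →ₗ[R] Module.End R (FreeLieAlgebra R X × R))

theorem euler_apply (u : FreeLieAlgebra R X) : euler R X u = (affineAd R X u (0, 1)).1 := rfl

@[simp]
theorem euler_of (s : X) : euler R X (of R s) = of R s := by
  simp [euler_apply, affineAd_of]

theorem affineAd_inl (u v : FreeLieAlgebra R X) : affineAd R X u (v, 0) = (⁅u, v⁆, 0) := by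
  let K : LieSubalgebra R (FreeLieAlgebra R X) :=
    { carrier := {u | ∀ v, affineAd R X u (v, 0) = (⁅u, v⁆, 0)}
      add_mem' := fun {a b} ha hb v => by simp [ha v, hb v]
      zero_mem' := fun v => by simp [Prod.mk_zero_zero]
      smul_mem' := fun c a ha v => by simp [ha v]
      lie_mem' := fun {a b} ha hb v => by
        simp [LieHom.map_lie, Ring.lie_def, ha _, hb _] }
  have hK : K = ⊤ := lieSubalgebra_eq_top_of_forall_of_mem K fun s v => by
    simp [affineAd_of]
  exact (hK ▸ LieSubalgebra.mem_top u : u ∈ K) v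

theorem affineAd_inr (u : FreeLieAlgebra R X) : affineAd R X u (0, 1) = (euler R X u, 0) := by
  let K : LieSubalgebra R (FreeLieAlgebra R X) :=
    { carrier := {u | (affineAd R X u (0, 1)).2 = 0}
      add_mem' := fun {a b} (ha : _ = _) (hb : _ = _) => by simp [ha, hb]
      zero_mem' := by simp
      smul_mem' := fun c a (ha : _ = _) => by simp [ha]
      lie_mem' := fun {a b} (ha : _ = _) (hb : _ = _) => by
        have ha' : affineAd R X a (0, 1) = ((affineAd R X a (0, 1)).1, 0) := Prod.ext rfl ha
        have hb' : affineAd R X b (0, 1) = ((affineAd R X b (0, 1)).1, 0) := Prod.ext rfl hb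
        simp only [Set.mem_ofPred_eq, LieHom.map_lie, Ring.lie_def, LinearMap.sub_apply,
          Module.End.mul_apply]
        rw [ha', hb', affineAd_inl, affineAd_inl]
        simp }
  have hK : K = ⊤ := lieSubalgebra_eq_top_of_forall_of_mem K fun s => by
    change (affineAd R X (of R s) (0, 1)).2 = 0
    simp [affineAd_of]
  exact Prod.ext rfl (hK ▸ LieSubalgebra.mem_top u : u ∈ K)

theorem euler_lie (u v : FreeLieAlgebra R X) :
    euler R X ⁅u, v⁆ = ⁅u, euler R X v⁆ + ⁅euler R X u, v⁆ := by
  rw [euler_apply, LieHom.map_lie, Ring.lie_def, LinearMap.sub_apply, Module.End.mul_apply,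
    Module.End.mul_apply, affineAd_inr, affineAd_inr, affineAd_inl, affineAd_inl, Prod.fst_sub,
    ← lie_skew v, sub_neg_eq_add]

variable (R X) in
/-- The canonical map from the free Lie algebra to the algebra of noncommutative polynomials. -/
noncomputable def toMonoidAlgebra :
    FreeLieAlgebra R X →ₗ⁅R⁆ MonoidAlgebra R (FreeMonoid X) :=
  lift R fun s => MonoidAlgebra.of R _ (FreeMonoid.of s)

variable (R X) in
/-- The extension of `affineAd` to noncommutative polynomials. -/
noncomputable def affineAdAlgHom :
    MonoidAlgebra R (FreeMonoid X) →ₐ[R] Module.End R (FreeLieAlgebra R X × R) :=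
  MonoidAlgebra.lift R _ _ (FreeMonoid.lift (affineAdOf R))

theorem affineAdAlgHom_toMonoidAlgebra (u : FreeLieAlgebra R X) :
    affineAdAlgHom R X (toMonoidAlgebra R X u) = affineAd R X u := by
  have key : (affineAdAlgHom R X).toLieHom.comp (toMonoidAlgebra R X) = affineAd R X :=
    hom_ext fun s => by
      simp [affineAdAlgHom, toMonoidAlgebra, affineAd_of]
  exact congr($key u)

end CommRing

theorem euler_injective {K : Type*} [Field K] [CharZero K] {X : Type*} :
    Function.Injective (euler K X) := by
  let P : Submodule K (FreeLieAlgebra K X) :=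
    ⨆ n : ℕ, (euler K X).eigenspace ((n : K) + 1)
  let L : LieSubalgebra K (FreeLieAlgebra K X) :=
    { P with
      lie_mem' := fun {a b} (ha : a ∈ P) (hb : b ∈ P) => by
        change ⁅a, b⁆ ∈ P
        induction ha using Submodule.iSup_induction' with
        | zero => simp
        | add x y _ _ hx hy => rw [add_lie]; exact add_mem hx hy
        | mem m x hx =>
          induction hb using Submodule.iSup_induction' with
          | zero => simp
          | add y z _ _ hy hz => rw [lie_add]; exact add_mem hy hz
          | mem n y hy =>
            refine Submodule.mem_iSup_of_mem (m + n + 1) ?_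
            rw [Module.End.mem_eigenspace_iff] at hx hy ⊢
            rw [euler_lie, hx, hy, lie_smul, smul_lie, ← add_smul]
            congr 1
            push_cast
            ring }
  have hL : L = ⊤ := lieSubalgebra_eq_top_of_forall_of_mem L fun s =>
    Submodule.mem_iSup_of_mem 0 (by simp)
  have hP : P = ⊤ := eq_top_iff.2 fun u _ => (hL ▸ LieSubalgebra.mem_top u : u ∈ L)
  have hdisj := (euler K X).eigenspaces_iSupIndep 0
  have hle : P ≤ ⨆ (μ : K) (_ : μ ≠ 0), (euler K X).eigenspace μ :=
    iSup_le fun n => le_iSup₂_of_le ((n : K) + 1) (Nat.cast_add_one_ne_zero n) le_rfl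
  rw [top_le_iff.1 (hP.ge.trans hle), disjoint_top, Module.End.eigenspace_zero] at hdisj
  exact LinearMap.ker_eq_bot.1 hdisj

end FreeLieAlgebra

namespace MonoidAlgebra

/-- The monomials of a noncommutative polynomial commuting with the variable `a` are powers
of `a`. -/
theorem coeff_eq_zero_of_commute_of {R X : Type*} [Semiring R] {a b : X} (hb : b ≠ a)
    {p : MonoidAlgebra R (FreeMonoid X)} (hp : Commute (of R _ (FreeMonoid.of a)) p)
    (i : ℕ) (u : FreeMonoid X) :
    p.coeff (FreeMonoid.of a ^ i * FreeMonoid.of b * u) = 0 := by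
  have hcomm (w : FreeMonoid X) :
      p.coeff w = (p * single (FreeMonoid.of a) 1).coeff (FreeMonoid.of a * w) := by
    have := congr(($hp.eq).coeff (FreeMonoid.of a * w))
    rw [of_apply] at this
    rw [← this, coeff_single_mul_eq_mul_coeff w (fun _ _ => mul_right_inj _), one_mul]
  have hend (w : FreeMonoid X) {c : X} (hc : c ≠ a) : p.coeff (w * FreeMonoid.of c) = 0 := by
    rw [hcomm, coeff_mul_single_of_forall_mul_ne]
    intro d hd
    rw [← mul_assoc] at hd
    have := congr(($hd).toList)
    simp only [FreeMonoid.toList_mul, FreeMonoid.toList_of] at this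
    exact hc (by simpa using (List.append_inj_right' this rfl).symm)
  have hshift (w : FreeMonoid X) :
      p.coeff (w * FreeMonoid.of a) = p.coeff (FreeMonoid.of a * w) := by
    rw [hcomm, coeff_mul_single_eq_coeff_mul (FreeMonoid.of a * w)
      (fun _ _ => by rw [← mul_assoc, mul_left_inj]), mul_one]
  obtain ⟨l, rfl⟩ := FreeMonoid.ofList.surjective u
  induction l using List.reverseRecOn generalizing i with
  | nil => simpa using hend _ hb
  | append_singleton l c ih =>
    rw [FreeMonoid.ofList_append, FreeMonoid.ofList_singleton, ← mul_assoc]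
    obtain rfl | hc := eq_or_ne c a
    · rw [hshift, ← mul_assoc, ← mul_assoc, ← pow_succ']
      exact ih _
    · exact hend _ hc

end MonoidAlgebra

namespace FreeMonoid

theorem eq_pow_or_exists_ne {X : Type*} (a : X) (w : FreeMonoid X) :
    (∃ n, w = of a ^ n) ∨ ∃ i b u, b ≠ a ∧ w = of a ^ i * of b * u := by
  induction w using FreeMonoid.inductionOn' with
  | one => exact .inl ⟨0, rfl⟩
  | of_mul c w ih =>
    obtain rfl | hc := eq_or_ne c a
    · obtain ⟨n, rfl⟩ | ⟨i, b, u, hb, rfl⟩ := ih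
      · exact .inl ⟨n + 1, (pow_succ' _ _).symm⟩
      · exact .inr ⟨i + 1, b, u, hb, by simp only [pow_succ', mul_assoc]⟩
    · exact .inr ⟨0, c, w, hc, by simp⟩

end FreeMonoid

namespace FreeLieAlgebra

attribute [local instance] LieRing.ofAssociativeRing

theorem affineAdOf_pow_apply_mem_span {R X : Type*} [CommRing R] (a : X) (n : ℕ) :
    ((affineAdOf R a ^ n) (0, 1)).1 ∈ Submodule.span R {of R a} := by
  match n with
  | 0 => simp
  | 1 => simp [Submodule.mem_span_singleton_self]
  | n + 2 =>
    have h : (affineAdOf R a ^ 2) (0, 1) = 0 := by simp [pow_two]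
    rw [pow_add, Module.End.mul_apply, h]
    simp

theorem euler_mem_span_of_lie_eq_zero {R X : Type*} [CommRing R] {a : X}
    {x : FreeLieAlgebra R X} (hx : ⁅of R a, x⁆ = 0) :
    euler R X x ∈ Submodule.span R {of R a} := by
  have hcomm : Commute (MonoidAlgebra.of R _ (FreeMonoid.of a)) (toMonoidAlgebra R X x) := by
    have h := congr(toMonoidAlgebra R X $hx)
    rwa [LieHom.map_lie, map_zero, Ring.lie_def, sub_eq_zero, toMonoidAlgebra,
      lift_of_apply] at h
  rw [euler_apply, ← affineAdAlgHom_toMonoidAlgebra, affineAdAlgHom, MonoidAlgebra.lift_apply,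
    Finsupp.sum, LinearMap.sum_apply, Prod.fst_sum]
  refine Submodule.sum_mem _ fun w _ => ?_
  obtain ⟨n, rfl⟩ | ⟨i, b, u, hb, rfl⟩ := FreeMonoid.eq_pow_or_exists_ne a w
  · rw [map_pow (FreeMonoid.lift _), FreeMonoid.lift_eval_of, LinearMap.smul_apply, Prod.smul_fst]
    exact Submodule.smul_mem _ _ (affineAdOf_pow_apply_mem_span a n)
  · rw [MonoidAlgebra.coeff_eq_zero_of_commute_of hb hcomm]
    simp

end FreeLieAlgebra


/-- In the free Lie algebra `FL(S) = FreeLieAlgebra ℚ S`, for every generator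
`of a` and every `x`, one has `⁅of a, x⁆ = 0` iff `x` is a ℚ-scalar multiple of `of a`:
the centralizer of a generator is its one-dimensional span. -/
theorem centralizer_of_generator (S : Type*) (a : S) (x : FreeLieAlgebra ℚ S) :
    ⁅FreeLieAlgebra.of ℚ a, x⁆ = 0 ↔ ∃ c : ℚ, x = c • FreeLieAlgebra.of ℚ a := by
  constructor
  · intro hx
    obtain ⟨c, hc⟩ := Submodule.mem_span_singleton.1
      (FreeLieAlgebra.euler_mem_span_of_lie_eq_zero hx)
    exact ⟨c, FreeLieAlgebra.euler_injective (by simp [← hc])⟩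
  · rintro ⟨c, rfl⟩
    simp
end

section
/- For all λ₁, λ₂ : S → FL(S), the tangential derivation of the tangential bracket equals the commutator of the tangential derivations: ∂_{[λ₁,λ₂]_tb} = ∂_{λ₁} ∘ ∂_{λ₂} − ∂_{λ₂} ∘ ∂_{λ₁} (the bracket of the Lie algebra of derivations). In particular, the set tder_S of tangential derivations is closed under the commutator bracket. -/
/-- The set of tangential derivations of the free Lie algebra `FL(S) = FreeLieAlgebra ℚ S`:
Lie derivations of the form `∂_μ`, i.e. those sending each generator `of a` to
`⁅of a, μ a⁆` for some family `μ : S → FL(S)`. -/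
def tderSet (S : Type*) :
    Set (LieDerivation ℚ (FreeLieAlgebra ℚ S) (FreeLieAlgebra ℚ S)) :=
  {D | ∃ μ : S → FreeLieAlgebra ℚ S,
    ∀ a : S, D (FreeLieAlgebra.of ℚ a) = ⁅FreeLieAlgebra.of ℚ a, μ a⁆}

namespace FreeLieAlgebra

theorem lieSpan_range_of (R X : Type*) [CommRing R] :
    LieSubalgebra.lieSpan R (FreeLieAlgebra R X) (Set.range (of R)) = ⊤ := by
  set K := LieSubalgebra.lieSpan R (FreeLieAlgebra R X) (Set.range (of R))
  let f : FreeLieAlgebra R X →ₗ⁅R⁆ K :=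
    lift R fun x => ⟨of R x, LieSubalgebra.subset_lieSpan ⟨x, rfl⟩⟩
  have hf : K.incl.comp f = LieHom.id := by
    ext x
    simp [f]
  refine eq_top_iff.2 fun y _ => ?_
  have hy : (f y : FreeLieAlgebra R X) = y := LieHom.congr_fun hf y
  exact hy ▸ (f y).2

theorem lieDerivation_ext {R X M : Type*} [CommRing R] [AddCommGroup M] [Module R M]
    [LieRingModule (FreeLieAlgebra R X) M] [LieModule R (FreeLieAlgebra R X) M]
    {D₁ D₂ : LieDerivation R (FreeLieAlgebra R X) M} (h : ∀ x, D₁ (of R x) = D₂ (of R x)) :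
    D₁ = D₂ :=
  LieDerivation.ext_of_lieSpan_eq_top _ (lieSpan_range_of R X) (by rintro _ ⟨x, rfl⟩; exact h x)

end FreeLieAlgebra

theorem LieDerivation.commutator_apply_of_apply_eq_lie {R L : Type*} [CommRing R] [LieRing L]
    [LieAlgebra R L] {D₁ D₂ : LieDerivation R L L} {x y₁ y₂ : L}
    (h₁ : D₁ x = ⁅x, y₁⁆) (h₂ : D₂ x = ⁅x, y₂⁆) :
    ⁅D₁, D₂⁆ x = ⁅x, ⁅y₁, y₂⁆ + D₁ y₂ - D₂ y₁⁆ := by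
  rw [LieDerivation.commutator_apply, h₁, h₂, LieDerivation.apply_lie_eq_add,
    LieDerivation.apply_lie_eq_add, h₁, h₂, lie_sub, lie_add, leibniz_lie x y₁ y₂,
    ← lie_skew y₁ ⁅x, y₂⁆]
  abel

/-- For all `λ₁, λ₂ : S → FL(S)`, the tangential derivation of the tangential
bracket `[λ₁,λ₂]_tb` (whose component at `a` is `⁅λ₁ a, λ₂ a⁆ + ∂_{λ₁}(λ₂ a) − ∂_{λ₂}(λ₁ a)`)
equals the commutator `⁅∂_{λ₁}, ∂_{λ₂}⁆` in the Lie algebra of derivations.  Here `∂_λ`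
is represented by any Lie derivation `D` with `D (of a) = ⁅of a, λ a⁆` for all `a` (it is
unique).  In particular (second conjunct), the set of tangential derivations is closed under
the commutator bracket. -/
theorem tangential_derivation_of_tb_eq_commutator (S : Type*) :
    (∀ (l₁ l₂ : S → FreeLieAlgebra ℚ S)
      (D₁ D₂ D₁₂ : LieDerivation ℚ (FreeLieAlgebra ℚ S) (FreeLieAlgebra ℚ S)),
      (∀ a : S, D₁ (FreeLieAlgebra.of ℚ a) = ⁅FreeLieAlgebra.of ℚ a, l₁ a⁆) →
      (∀ a : S, D₂ (FreeLieAlgebra.of ℚ a) = ⁅FreeLieAlgebra.of ℚ a, l₂ a⁆) →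
      (∀ a : S, D₁₂ (FreeLieAlgebra.of ℚ a) =
        ⁅FreeLieAlgebra.of ℚ a, ⁅l₁ a, l₂ a⁆ + D₁ (l₂ a) - D₂ (l₁ a)⁆) →
      D₁₂ = ⁅D₁, D₂⁆) ∧
    (∀ D₁ D₂, D₁ ∈ tderSet S → D₂ ∈ tderSet S → ⁅D₁, D₂⁆ ∈ tderSet S) := by
  refine ⟨fun l₁ l₂ D₁ D₂ D₁₂ h₁ h₂ h₁₂ => ?_, ?_⟩
  · refine FreeLieAlgebra.lieDerivation_ext fun a => ?_
    rw [h₁₂, LieDerivation.commutator_apply_of_apply_eq_lie (h₁ a) (h₂ a)]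
  · rintro D₁ D₂ ⟨l₁, h₁⟩ ⟨l₂, h₂⟩
    exact ⟨fun a => ⁅l₁ a, l₂ a⁆ + D₁ (l₂ a) - D₂ (l₁ a), fun a =>
      LieDerivation.commutator_apply_of_apply_eq_lie (h₁ a) (h₂ a)⟩
end
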